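/- Under the positive-unlabeled learning setup, suppose C ≥ 1, 0 < ρ < 1/(3C), and U(T) ≥ e^{−C}·Q(T)^C for every Borel set T ⊆ ℝ^d. Then, writing S_OPT := P ∖ B_{1/2}, for every Borel set S ⊆ ℝ^d one has Err(S) − Err(S_OPT) ≥ ρ·e^{−C}·( (Q(S ∖ P) + Q(S_OPT ∖ S ∖ B_{1/3})) / 2 )^C. -/

import Mathlib

open MeasureTheory Set
open scoped ProbabilityTheory ENNReal symmDiff

noncomputable section

/-- The noise rate `γ(x) = ρ·u(x)/(ρ·u(x) + (1−ρ)·p(x))` for `x ∈ P`, and `0` otherwise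
(note that in `ℝ≥0∞` the quotient `0/0` is `0`, so the convention for a vanishing
denominator is automatic since `ρ > 0` forces the numerator to vanish as well). -/
noncomputable def noiseRate {d : ℕ} (P : Set (EuclideanSpace ℝ (Fin d))) (ρ : ℝ)
    (p u : EuclideanSpace ℝ (Fin d) → ℝ≥0∞) (x : EuclideanSpace ℝ (Fin d)) : ℝ≥0∞ :=
  P.indicator
    (fun x => (ENNReal.ofReal ρ * u x) /
      (ENNReal.ofReal ρ * u x + ENNReal.ofReal (1 - ρ) * p x)) x

/-- The high-noise region `B_z = {x ∈ P : γ(x) ≥ z}`. -/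
noncomputable def highNoise {d : ℕ} (P : Set (EuclideanSpace ℝ (Fin d))) (ρ : ℝ)
    (p u : EuclideanSpace ℝ (Fin d) → ℝ≥0∞) (z : ℝ) : Set (EuclideanSpace ℝ (Fin d)) :=
  {x ∈ P | ENNReal.ofReal z ≤ noiseRate P ρ p u x}

/-- The classification error `Err(S) = ρ·U(S) + (1−ρ)·𝒫(ℝ^d ∖ S)`. -/
noncomputable def classErr {d : ℕ} (U Pm : Measure (EuclideanSpace ℝ (Fin d))) (ρ : ℝ)
    (S : Set (EuclideanSpace ℝ (Fin d))) : ℝ :=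
  ρ * (U S).toReal + (1 - ρ) * (Pm Sᶜ).toReal

lemma mul_withDensity_real_le {α : Type*} [MeasurableSpace α] {ν : Measure α}
    {f g : α → ℝ≥0∞} (hf : Measurable f) (hg : Measurable g)
    [IsFiniteMeasure (ν.withDensity f)] [IsFiniteMeasure (ν.withDensity g)]
    {a b : ℝ} (ha : 0 ≤ a) (hb : 0 ≤ b) {T : Set α} (hT : MeasurableSet T)
    (h : ∀ᵐ x ∂ν, x ∈ T → ENNReal.ofReal a * f x ≤ ENNReal.ofReal b * g x) :
    a * (ν.withDensity f).real T ≤ b * (ν.withDensity g).real T := by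
  have key : ENNReal.ofReal a * ν.withDensity f T ≤ ENNReal.ofReal b * ν.withDensity g T := by
    rw [withDensity_apply _ hT, withDensity_apply _ hT, ← lintegral_const_mul _ hf,
      ← lintegral_const_mul _ hg]
    exact lintegral_mono_ae ((ae_restrict_iff' hT).2 h)
  have := ENNReal.toReal_mono (ENNReal.mul_ne_top ENNReal.ofReal_ne_top (measure_ne_top _ _)) key
  simpa [ENNReal.toReal_mul, ENNReal.toReal_ofReal, ha, hb, Measure.real] using this

lemma ae_ne_top_of_isFiniteMeasure_withDensity {α : Type*} [MeasurableSpace α] {ν : Measure α}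
    {f : α → ℝ≥0∞} (hf : Measurable f) [IsFiniteMeasure (ν.withDensity f)] :
    ∀ᵐ x ∂ν, f x ≠ ∞ := by
  have h : ∫⁻ x, f x ∂ν ≠ ∞ := by
    rw [← setLIntegral_univ, ← withDensity_apply _ MeasurableSet.univ]
    exact measure_ne_top _ _
  filter_upwards [ae_lt_top hf h] with x hx using hx.ne

lemma measurable_noiseRate {d : ℕ} {P : Set (EuclideanSpace ℝ (Fin d))} (hP : MeasurableSet P)
    (ρ : ℝ) {p u : EuclideanSpace ℝ (Fin d) → ℝ≥0∞} (hp : Measurable p) (hu : Measurable u) :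
    Measurable (noiseRate P ρ p u) :=
  Measurable.indicator (by fun_prop) hP

lemma measurableSet_highNoise {d : ℕ} {P : Set (EuclideanSpace ℝ (Fin d))}
    (hP : MeasurableSet P) (ρ : ℝ) {p u : EuclideanSpace ℝ (Fin d) → ℝ≥0∞}
    (hp : Measurable p) (hu : Measurable u) (z : ℝ) :
    MeasurableSet (highNoise P ρ p u z) :=
  hP.inter (measurableSet_le measurable_const (measurable_noiseRate hP ρ hp hu))

lemma ofReal_le_div_add_iff {z : ℝ} (hz : 0 < z) {r s : ℝ≥0∞} (hr : r ≠ ∞) (hs : s ≠ ∞)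
    (hrs : r + s ≠ 0) :
    ENNReal.ofReal z ≤ r / (r + s) ↔ z * (r.toReal + s.toReal) ≤ r.toReal := by
  have hne : r + s ≠ ∞ := ENNReal.add_ne_top.2 ⟨hr, hs⟩
  rw [ENNReal.le_div_iff_mul_le (Or.inl hrs) (Or.inl hne),
    ← ENNReal.toReal_le_toReal (ENNReal.mul_ne_top ENNReal.ofReal_ne_top hne) hr,
    ENNReal.toReal_mul, ENNReal.toReal_ofReal hz.le, ENNReal.toReal_add hr hs]

lemma le_of_half_le_div_add {r s : ℝ≥0∞} (hr : r ≠ ∞) (hs : s ≠ ∞)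
    (h : ENNReal.ofReal (1 / 2) ≤ r / (r + s)) : s ≤ r := by
  by_cases h0 : r + s = 0
  · simp_all
  rw [ofReal_le_div_add_iff (by norm_num) hr hs h0] at h
  rw [← ENNReal.toReal_le_toReal hs hr]
  linarith

lemma le_of_not_half_le_div_add {r s : ℝ≥0∞} (hr : r ≠ ∞) (hs : s ≠ ∞)
    (h : ¬ ENNReal.ofReal (1 / 2) ≤ r / (r + s)) : r ≤ s := by
  by_cases h0 : r + s = 0
  · simp_all
  rw [ofReal_le_div_add_iff (by norm_num) hr hs h0] at h
  rw [← ENNReal.toReal_le_toReal hr hs]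
  linarith

lemma two_mul_le_of_not_third_le_div_add {r s : ℝ≥0∞} (hr : r ≠ ∞) (hs : s ≠ ∞)
    (h : ¬ ENNReal.ofReal (1 / 3) ≤ r / (r + s)) : 2 * r ≤ s := by
  by_cases h0 : r + s = 0
  · simp_all
  rw [ofReal_le_div_add_iff (by norm_num) hr hs h0] at h
  rw [← ENNReal.toReal_le_toReal (ENNReal.mul_ne_top (by simp) hr) hs, ENNReal.toReal_mul]
  simp only [ENNReal.toReal_ofNat]
  linarith

lemma midpoint_rpow_le_add_rpow {a b C : ℝ} (ha : 0 ≤ a) (hb : 0 ≤ b) (hC : 1 ≤ C) :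
    ((a + b) / 2) ^ C ≤ a ^ C + b ^ C := by
  have h := (convexOn_rpow hC).2 (Set.mem_Ici.2 ha) (Set.mem_Ici.2 hb)
    (by norm_num : (0 : ℝ) ≤ 1 / 2) (by norm_num : (0 : ℝ) ≤ 1 / 2) (by norm_num)
  simp only [smul_eq_mul] at h
  rw [show (a + b) / 2 = 1 / 2 * a + 1 / 2 * b by ring]
  have := Real.rpow_nonneg ha C
  have := Real.rpow_nonneg hb C
  linarith

theorem stmt4 {d : ℕ}
    (Q U ν : Measure (EuclideanSpace ℝ (Fin d)))
    [IsProbabilityMeasure Q] [IsProbabilityMeasure U] [SigmaFinite ν]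
    (P : Set (EuclideanSpace ℝ (Fin d))) (hP : MeasurableSet P) (hQP : 0 < Q P)
    (p u : EuclideanSpace ℝ (Fin d) → ℝ≥0∞) (hp : Measurable p) (hu : Measurable u)
    (hPdens : Q[|P] = ν.withDensity p)
    (hUdens : U = ν.withDensity u)
    (hpP : ∀ᵐ x ∂ν, x ∉ P → p x = 0)
    (ρ : ℝ) (hρ : ρ ∈ Set.Ioo (0 : ℝ) 1)
    (C : ℝ) (hC : 1 ≤ C) (hρC : ρ < 1 / (3 * C))
    (hUQ : ∀ T : Set (EuclideanSpace ℝ (Fin d)), MeasurableSet T →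
      Real.exp (-C) * (Q T).toReal ^ C ≤ (U T).toReal)
    (S : Set (EuclideanSpace ℝ (Fin d))) (hS : MeasurableSet S) :
    ρ * Real.exp (-C) *
        (((Q (S \ P)).toReal
            + (Q (((P \ highNoise P ρ p u (1 / 2)) \ S) \ highNoise P ρ p u (1 / 3))).toReal)
          / 2) ^ C ≤
      classErr U Q[|P] ρ S - classErr U Q[|P] ρ (P \ highNoise P ρ p u (1 / 2)) := by
  obtain ⟨hρ0, hρ1⟩ := hρ
  have hQP' : Q P ≠ 0 := hQP.ne'
  have : IsProbabilityMeasure Q[|P] := ProbabilityTheory.cond_isProbabilityMeasure hQP'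
  have : IsFiniteMeasure (ν.withDensity p) := hPdens ▸ inferInstance
  have : IsFiniteMeasure (ν.withDensity u) := hUdens ▸ inferInstance
  have hB2 := measurableSet_highNoise hP ρ hp hu (1 / 2)
  have hB3 := measurableSet_highNoise hP ρ hp hu (1 / 3)
  have hrate : ∀ x ∈ P, noiseRate P ρ p u x = (ENNReal.ofReal ρ * u x) /
      (ENNReal.ofReal ρ * u x + ENNReal.ofReal (1 - ρ) * p x) :=
    fun x hx => Set.indicator_of_mem hx _
  have hfin : ∀ᵐ x ∂ν, ENNReal.ofReal ρ * u x ≠ ∞ ∧ ENNReal.ofReal (1 - ρ) * p x ≠ ∞ := by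
    filter_upwards [ae_ne_top_of_isFiniteMeasure_withDensity (ν := ν) hu,
      ae_ne_top_of_isFiniteMeasure_withDensity (ν := ν) hp] with x hux hpx
    exact ⟨ENNReal.mul_ne_top ENNReal.ofReal_ne_top hux,
      ENNReal.mul_ne_top ENNReal.ofReal_ne_top hpx⟩
  set B := highNoise P ρ p u (1 / 2) with hB
  set B' := highNoise P ρ p u (1 / 3) with hB'
  set O := P \ B with hO
  have hOm : MeasurableSet O := hP.diff hB2
  have hBP : B ⊆ P := fun x hx => hx.1
  have hSB : (1 - ρ) * (Q[|P]).real (S ∩ B) ≤ ρ * U.real (S ∩ B) := by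
    rw [hPdens, hUdens]
    refine mul_withDensity_real_le hp hu (by linarith) hρ0.le (hS.inter hB2) ?_
    filter_upwards [hfin] with x hx hxT
    have h := hxT.2.2
    rw [hrate x hxT.2.1] at h
    exact le_of_half_le_div_add hx.1 hx.2 h
  have hE : ρ * U.real ((O \ S) ∩ B') ≤ (1 - ρ) * (Q[|P]).real ((O \ S) ∩ B') := by
    rw [hPdens, hUdens]
    refine mul_withDensity_real_le hu hp hρ0.le (by linarith)
      ((hOm.diff hS).inter hB3) ?_
    filter_upwards [hfin] with x hx hxT
    have hxP : x ∈ P := hxT.1.1.1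
    have h : ¬ _ := fun h => hxT.1.1.2 (show x ∈ B from ⟨hxP, h⟩)
    rw [hrate x hxP] at h
    exact le_of_not_half_le_div_add hx.1 hx.2 h
  have hD : (2 * ρ) * U.real ((O \ S) \ B') ≤ (1 - ρ) * (Q[|P]).real ((O \ S) \ B') := by
    rw [hPdens, hUdens]
    refine mul_withDensity_real_le hu hp (by linarith) (by linarith)
      ((hOm.diff hS).diff hB3) ?_
    filter_upwards [hfin] with x hx hxT
    have hxP : x ∈ P := hxT.1.1.1
    have h : ¬ _ := fun h => hxT.2 (show x ∈ B' from ⟨hxP, h⟩)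
    rw [hrate x hxP] at h
    rw [ENNReal.ofReal_mul (by norm_num), ENNReal.ofReal_ofNat, mul_assoc]
    exact two_mul_le_of_not_third_le_div_add hx.1 hx.2 h
  have hSP : (Q[|P]).real (S \ P) = 0 := by
    have h : P ∩ (S \ P) = ∅ := by ext; simp
    simp [Measure.real, ProbabilityTheory.cond_apply hP, h]
  have hsplitS (m : Measure (EuclideanSpace ℝ (Fin d))) [IsFiniteMeasure m] :
      m.real S = m.real (S \ P) + m.real (S ∩ B) + m.real (O ∩ S) := by
    rw [← measureReal_inter_add_sdiff (s := S) hP, ← measureReal_inter_add_sdiff (s := S ∩ P) hB2,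
      show S ∩ P ∩ B = S ∩ B by rw [inter_assoc, inter_eq_right.2 hBP],
      show (S ∩ P) \ B = O ∩ S by ext; simp [hO]; tauto]
    ring
  have hsplitO (m : Measure (EuclideanSpace ℝ (Fin d))) [IsFiniteMeasure m] :
      m.real O = m.real (O ∩ S) + m.real ((O \ S) ∩ B') + m.real ((O \ S) \ B') := by
    rw [← measureReal_inter_add_sdiff (s := O) hS, ← measureReal_inter_add_sdiff (s := O \ S) hB3]
    ring
  have hErr (T : Set (EuclideanSpace ℝ (Fin d))) (hT : MeasurableSet T) :
      classErr U Q[|P] ρ T = ρ * U.real T + (1 - ρ) * (1 - (Q[|P]).real T) := by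
    rw [← probReal_compl_eq_one_sub hT]
    rfl
  have h1 := hUQ (S \ P) (hS.diff hP)
  have h2 := hUQ ((O \ S) \ B') ((hOm.diff hS).diff hB3)
  change _ ≤ U.real _ at h1 h2
  have hconv := midpoint_rpow_le_add_rpow (a := (Q (S \ P)).toReal)
    (b := (Q ((O \ S) \ B')).toReal) ENNReal.toReal_nonneg ENNReal.toReal_nonneg hC
  have hbound : ρ * Real.exp (-C) *
      (((Q (S \ P)).toReal + (Q ((O \ S) \ B')).toReal) / 2) ^ C ≤
      ρ * (U.real (S \ P) + U.real ((O \ S) \ B')) := by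
    rw [mul_assoc]
    refine mul_le_mul_of_nonneg_left ?_ hρ0.le
    have := mul_le_mul_of_nonneg_left hconv (Real.exp_pos (-C)).le
    linarith
  rw [hErr S hS, hErr O hOm, hsplitS U, hsplitS Q[|P], hsplitO U, hsplitO Q[|P], hSP]
  linarith
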